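/- arXiv:1612.04942 — 7 statements merged into one kernel-verified Lean document; each statement's English description precedes it below -/
import Mathlib

section
/- Let λ ∈ [0,1], let Q be symmetric positive semidefinite and R symmetric positive definite. If X and Y are symmetric matrices with 0 ⪯ X ⪯ Y, then g_λ(X) ⪯ g_λ(Y); i.e., the modified Riccati operator g_λ is monotone on the positive semidefinite cone with respect to the Loewner order. -/
open Matrix Filter

noncomputable def gOp {n m : ℕ} (A : Matrix (Fin n) (Fin n) ℝ) (C : Matrix (Fin m) (Fin n) ℝ)
    (Q : Matrix (Fin n) (Fin n) ℝ) (R : Matrix (Fin m) (Fin m) ℝ)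
    (lam : ℝ) (X : Matrix (Fin n) (Fin n) ℝ) : Matrix (Fin n) (Fin n) ℝ :=
  A * X * Aᵀ + Q - lam • (A * X * Cᵀ * (C * X * Cᵀ + R)⁻¹ * C * X * Aᵀ)

/-- Completion of squares for the Kalman update. -/
lemma kalman_square {n m : ℕ} (C : Matrix (Fin m) (Fin n) ℝ) (R : Matrix (Fin m) (Fin m) ℝ)
    (X : Matrix (Fin n) (Fin n) ℝ) (S V : Matrix (Fin m) (Fin m) ℝ)
    (K : Matrix (Fin n) (Fin m) ℝ) (hS : S = C * X * Cᵀ + R) (hX : Xᵀ = X) (hVt : Vᵀ = V)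
    (h1 : S * V = 1) (h2 : V * S = 1) :
    (1 - K * C) * X * (1 - K * C)ᵀ + K * R * Kᵀ =
      (X - X * Cᵀ * V * C * X) + (K - X * Cᵀ * V) * S * (K - X * Cᵀ * V)ᵀ := by
  have hR : R = S - C * X * Cᵀ := by rw [hS]; abel
  have e1 : (K - X * Cᵀ * V) * S = K * S - X * Cᵀ := by
    rw [Matrix.sub_mul, Matrix.mul_assoc (X * Cᵀ), h2, Matrix.mul_one]
  have e2 : (K - X * Cᵀ * V)ᵀ = Kᵀ - V * (C * X) := by
    simp [Matrix.transpose_mul, hX, hVt, Matrix.mul_assoc]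
  have e3 : K * S * (V * (C * X)) = K * (C * X) := by
    rw [Matrix.mul_assoc, ← Matrix.mul_assoc S, h1, Matrix.one_mul]
  rw [e1, e2, Matrix.sub_mul (K * S), Matrix.mul_sub (K * S), e3, hR]
  simp only [Matrix.transpose_sub, Matrix.transpose_one, Matrix.transpose_mul, Matrix.sub_mul,
    Matrix.mul_sub, Matrix.mul_one, Matrix.one_mul, Matrix.mul_assoc]
  abel

/-- Monotonicity of the modified Riccati operator on the PSD cone (Loewner order). -/
theorem riccati_monotone {n m : ℕ} (hn : 1 ≤ n)
    (A : Matrix (Fin n) (Fin n) ℝ) (C : Matrix (Fin m) (Fin n) ℝ)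
    (Q : Matrix (Fin n) (Fin n) ℝ) (R : Matrix (Fin m) (Fin m) ℝ)
    (hQ : Q.PosSemidef) (hR : R.PosDef)
    (lam : ℝ) (hlam : lam ∈ Set.Icc (0 : ℝ) 1)
    (X Y : Matrix (Fin n) (Fin n) ℝ)
    (hX : X.PosSemidef) (hY : Y.IsHermitian) (hXY : (Y - X).PosSemidef) :
    (gOp A C Q R lam Y - gOp A C Q R lam X).PosSemidef := by
  obtain ⟨h0, h1⟩ := hlam
  have hYp : Y.PosSemidef := by simpa using hX.add hXY
  have key : ∀ Z : Matrix (Fin n) (Fin n) ℝ, Z.PosSemidef → (C * Z * Cᵀ + R).PosDef := by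
    intro Z hZ
    have := hZ.mul_mul_conjTranspose_same C
    rw [conjTranspose_eq_transpose_of_trivial] at this
    exact Matrix.PosDef.posSemidef_add this hR
  have hSX := key X hX
  have hSY := key Y hYp
  have sq : ∀ Z : Matrix (Fin n) (Fin n) ℝ, Z.PosSemidef → ∀ K : Matrix (Fin n) (Fin m) ℝ, _ :=
    fun Z hZ K => kalman_square C R Z (C * Z * Cᵀ + R) (C * Z * Cᵀ + R)⁻¹ K rfl
      (by simpa [IsHermitian, conjTranspose_eq_transpose_of_trivial] using hZ.isHermitian)
      (by simpa only [IsHermitian, conjTranspose_eq_transpose_of_trivial]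
            using (key Z hZ).inv.isHermitian)
      (Matrix.mul_nonsing_inv _ ((Matrix.isUnit_iff_isUnit_det _).1 (key Z hZ).isUnit))
      (Matrix.nonsing_inv_mul _ ((Matrix.isUnit_iff_isUnit_det _).1 (key Z hZ).isUnit))
  have sX := sq X hX (Y * Cᵀ * (C * Y * Cᵀ + R)⁻¹)
  have sY := sq Y hYp (Y * Cᵀ * (C * Y * Cᵀ + R)⁻¹)
  unfold gOp
  generalize hSXe : C * X * Cᵀ + R = SX at *
  generalize hVY : (C * Y * Cᵀ + R)⁻¹ = VY at *
  generalize hVX : SX⁻¹ = VX at *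
  generalize hK : Y * Cᵀ * VY = K at *
  rw [sub_self, Matrix.zero_mul, Matrix.zero_mul, add_zero] at sY
  have p1 := hXY.mul_mul_conjTranspose_same (1 - K * C)
  have p2 := hSX.posSemidef.mul_mul_conjTranspose_same (K - X * Cᵀ * VX)
  rw [conjTranspose_eq_transpose_of_trivial] at p1 p2
  have p3 : ((Y - K * C * Y) - (X - X * Cᵀ * VX * C * X)).PosSemidef := by
    convert p1.add p2 using 1
    rw [← sY, Matrix.mul_sub (1 - K * C) Y X, Matrix.sub_mul ((1 - K * C) * Y), ← sub_eq_iff_eq_add'.2 sX]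
    abel
  have p4 := (p3.mul_mul_conjTranspose_same A).smul h0
  have p5 := (hXY.mul_mul_conjTranspose_same A).smul (sub_nonneg.2 h1)
  rw [conjTranspose_eq_transpose_of_trivial] at p4 p5
  convert p5.add p4 using 1
  rw [← hK]
  simp only [Matrix.sub_mul, Matrix.mul_sub, Matrix.mul_assoc, smul_sub, sub_smul, one_smul]
  abel
end

section
/- Let λ ∈ [0,1], X symmetric positive semidefinite, Q symmetric positive semidefinite and R symmetric positive definite. Then (1−λ) • (A X Aᵀ) + Q ⪯ g_λ(X) ⪯ A X Aᵀ + Q. (The lower bound uses that A X Cᵀ (C X Cᵀ + R)⁻¹ C X Aᵀ ⪯ A X Aᵀ; this sandwich underlies the lower bound on the eavesdropper's expected error in Proposition 1.) -/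
open Matrix Filter

lemma joseph_posSemidef {n m : ℕ} (C : Matrix (Fin m) (Fin n) ℝ)
    (R S T : Matrix (Fin m) (Fin m) ℝ) (X : Matrix (Fin n) (Fin n) ℝ)
    (hR : R.PosSemidef) (hX : X.PosSemidef) (hS : S = C * X * Cᵀ + R)
    (hT : Tᵀ = T) (hTS : T * S = 1) : (X - X * Cᵀ * T * C * X).PosSemidef := by
  have hXt : Xᵀ = X := by simpa [conjTranspose_eq_transpose_of_trivial] using hX.isHermitian.eq
  have h1 := hX.mul_mul_conjTranspose_same (1 - X * Cᵀ * T * C)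
  have h2 := hR.mul_mul_conjTranspose_same (X * Cᵀ * T)
  have h := h1.add h2
  have hR' : R = S - C * X * Cᵀ := by rw [hS]; abel
  have hTS' : ∀ M : Matrix (Fin m) (Fin n) ℝ, T * (S * M) = M := by
    intro M; rw [← Matrix.mul_assoc, hTS, Matrix.one_mul]
  convert h using 1
  simp only [conjTranspose_eq_transpose_of_trivial, transpose_sub, transpose_mul, transpose_one,
    transpose_transpose, hT, hXt, hR', Matrix.mul_sub, Matrix.sub_mul, Matrix.mul_one,
    Matrix.one_mul, Matrix.mul_assoc, hTS']
  abel

/-- Sandwich bounds for the modified Riccati operator: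
`(1−λ) • (A X Aᵀ) + Q ⪯ g_λ(X) ⪯ A X Aᵀ + Q`. -/
theorem riccati_sandwich {n m : ℕ} (hn : 1 ≤ n)
    (A : Matrix (Fin n) (Fin n) ℝ) (C : Matrix (Fin m) (Fin n) ℝ)
    (Q : Matrix (Fin n) (Fin n) ℝ) (R : Matrix (Fin m) (Fin m) ℝ)
    (hQ : Q.PosSemidef) (hR : R.PosDef)
    (lam : ℝ) (hlam : lam ∈ Set.Icc (0 : ℝ) 1)
    (X : Matrix (Fin n) (Fin n) ℝ) (hX : X.PosSemidef) :
    (gOp A C Q R lam X - ((1 - lam) • (A * X * Aᵀ) + Q)).PosSemidef ∧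
      ((A * X * Aᵀ + Q) - gOp A C Q R lam X).PosSemidef := by
  have hS : (C * X * Cᵀ + R).PosDef := by
    have := hX.mul_mul_conjTranspose_same C
    rw [conjTranspose_eq_transpose_of_trivial] at this
    exact PosDef.posSemidef_add this hR
  have hXt : Xᵀ = X := by simpa [conjTranspose_eq_transpose_of_trivial] using hX.isHermitian.eq
  have hT := hS.inv
  have hTt : ((C * X * Cᵀ + R)⁻¹)ᵀ = (C * X * Cᵀ + R)⁻¹ := by
    simpa only [conjTranspose_eq_transpose_of_trivial] using hT.isHermitian.eq
  have hTS : (C * X * Cᵀ + R)⁻¹ * (C * X * Cᵀ + R) = 1 :=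
    Matrix.nonsing_inv_mul _ ((Matrix.isUnit_iff_isUnit_det _).mp hS.isUnit)
  have hJ := joseph_posSemidef C R _ _ X hR.posSemidef hX rfl hTt hTS
  unfold gOp
  generalize (C * X * Cᵀ + R)⁻¹ = T at *
  constructor
  · have h := (hJ.mul_mul_conjTranspose_same A).smul hlam.1
    convert h using 1
    simp only [conjTranspose_eq_transpose_of_trivial, Matrix.mul_sub, Matrix.sub_mul,
      Matrix.mul_assoc, smul_sub, sub_smul, one_smul]
    abel
  · have hTp : T.PosSemidef := hT.posSemidef
    have h := (hTp.mul_mul_conjTranspose_same (A * X * Cᵀ)).smul hlam.1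
    convert h using 1
    simp only [conjTranspose_eq_transpose_of_trivial, transpose_mul, transpose_transpose, hXt,
      Matrix.mul_assoc]
    abel
end

section
/- Let λ ∈ [0,1], β ≥ 1 a real number, X symmetric positive semidefinite, Q symmetric positive semidefinite and R symmetric positive definite. Then g_λ(β • X) ⪯ β • g_λ(X). (The modified Riccati operator is also monotone in Q and R, which for β ≥ 1 yields this scaling inequality.) -/
open Matrix Filter

theorem aux_inv_antitone {m : ℕ} (P T : Matrix (Fin m) (Fin m) ℝ)
    (hP : P.PosDef) (hT : T.PosDef) (h : (T - P).PosSemidef) :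
    (P⁻¹ - T⁻¹).PosSemidef := by
  have := hT.isUnit.invertible
  have := hP.isUnit.invertible
  have := hP.inv.isUnit.invertible
  have h1 := PosDef.fromBlocks₁₁ (1 : Matrix (Fin m) (Fin m) ℝ) P⁻¹ hT
  have h2 := PosDef.fromBlocks₂₂ T (1 : Matrix (Fin m) (Fin m) ℝ) hP.inv
  have h3 := h1.mp (h2.mpr (by simpa using h))
  simpa using h3

/-- Scaling inequality for the modified Riccati operator: for β ≥ 1,
`g_λ(β • X) ⪯ β • g_λ(X)`. -/
theorem riccati_scaling {n m : ℕ} (hn : 1 ≤ n)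
    (A : Matrix (Fin n) (Fin n) ℝ) (C : Matrix (Fin m) (Fin n) ℝ)
    (Q : Matrix (Fin n) (Fin n) ℝ) (R : Matrix (Fin m) (Fin m) ℝ)
    (hQ : Q.PosSemidef) (hR : R.PosDef)
    (lam : ℝ) (hlam : lam ∈ Set.Icc (0 : ℝ) 1)
    (β : ℝ) (hβ : 1 ≤ β)
    (X : Matrix (Fin n) (Fin n) ℝ) (hX : X.PosSemidef) :
    (β • gOp A C Q R lam X - gOp A C Q R lam (β • X)).PosSemidef := by
  have hβ0 : 0 < β := by linarith
  have hS : (C * X * Cᵀ).PosSemidef := by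
    simpa using hX.mul_mul_conjTranspose_same C
  have hM : (C * X * Cᵀ + R).PosDef := hR.posSemidef_add hS
  have hN : (β • (C * X * Cᵀ) + R).PosDef := hR.posSemidef_add (hS.smul hβ0.le)
  have hT : (β • (C * X * Cᵀ + R)).PosDef := hM.smul hβ0
  have hD := aux_inv_antitone _ _ hN hT (by
    have : β • (C * X * Cᵀ + R) - (β • (C * X * Cᵀ) + R) = (β - 1) • R := by
      module
    rw [this]
    exact hR.posSemidef.smul (by linarith))
  have hTinv : (β • (C * X * Cᵀ + R))⁻¹ = β⁻¹ • (C * X * Cᵀ + R)⁻¹ := by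
    apply Matrix.inv_eq_right_inv
    rw [Matrix.smul_mul, Matrix.mul_smul, smul_smul, mul_inv_cancel₀ hβ0.ne', one_smul]
    exact Matrix.mul_nonsing_inv _ ((Matrix.isUnit_iff_isUnit_det _).mp hM.isUnit)
  rw [hTinv] at hD
  have hK := hD.mul_mul_conjTranspose_same (A * X * Cᵀ)
  have hXt : Xᵀ = X := by
    have h := hX.isHermitian.eq
    rwa [conjTranspose_eq_transpose_of_trivial] at h
  have key : β • gOp A C Q R lam X - gOp A C Q R lam (β • X) =
      (β - 1) • Q + (lam * β ^ 2) • ((A * X * Cᵀ) *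
        ((β • (C * X * Cᵀ) + R)⁻¹ - β⁻¹ • (C * X * Cᵀ + R)⁻¹) * (A * X * Cᵀ)ᴴ) := by
    simp only [gOp, conjTranspose_eq_transpose_of_trivial, Matrix.transpose_mul,
      Matrix.transpose_transpose, hXt, Matrix.mul_sub, Matrix.sub_mul, Matrix.mul_smul,
      Matrix.smul_mul, Matrix.mul_assoc, smul_sub, smul_add, smul_smul]
    have : lam * β ^ 2 * β⁻¹ = lam * β := by field_simp
    rw [this]
    module
  rw [key]
  exact (hQ.smul (by linarith)).add (hK.smul (mul_nonneg hlam.1 (by positivity)))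
end

section
/- Let Q be symmetric positive semidefinite, R symmetric positive definite, β ≥ 1 a real number, and γ : ℕ → Bool an arbitrary packet-success sequence. Let P and P' be sequences of n×n matrices with P(0) and P'(0) symmetric positive semidefinite, P'(0) ⪯ β • P(0), and for all k: P(k+1) = g₁(P(k)) if γ(k) = true and P(k+1) = g₀(P(k)) = A P(k) Aᵀ + Q if γ(k) = false, and identically for P'. Then P'(k) ⪯ β • P(k) for all k ≥ 0. -/
open Matrix Filter

/-- Completion of squares for the Riccati operator. -/
lemma gOp_one_complete {n m : ℕ} (A : Matrix (Fin n) (Fin n) ℝ) (C : Matrix (Fin m) (Fin n) ℝ)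
    (Q : Matrix (Fin n) (Fin n) ℝ) (R : Matrix (Fin m) (Fin m) ℝ) (hR : R.PosDef)
    (X : Matrix (Fin n) (Fin n) ℝ) (hX : X.PosSemidef) (K : Matrix (Fin n) (Fin m) ℝ) :
    gOp A C Q R 1 X = (A - K * C) * X * (A - K * C)ᵀ + Q + K * R * Kᵀ
      - (K - A * X * Cᵀ * (C * X * Cᵀ + R)⁻¹) * (C * X * Cᵀ + R)
        * (K - A * X * Cᵀ * (C * X * Cᵀ + R)⁻¹)ᵀ := by
  have hXt : Xᵀ = X := by simpa using hX.isHermitian.eq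
  have hS : (C * X * Cᵀ + R).PosDef := by
    have := hX.mul_mul_conjTranspose_same C
    rw [conjTranspose_eq_transpose_of_trivial] at this
    exact PosDef.posSemidef_add this hR
  have hSt : (C * X * Cᵀ + R)⁻¹ᵀ = (C * X * Cᵀ + R)⁻¹ := by
    simpa using hS.inv.isHermitian.eq
  have hdet : IsUnit (C * X * Cᵀ + R).det := (isUnit_iff_isUnit_det _).1 hS.isUnit
  have h1 := Matrix.mul_nonsing_inv _ hdet
  have h2 := Matrix.nonsing_inv_mul _ hdet
  have hexp : (C * X * Cᵀ + R) = C * X * Cᵀ + R := rfl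
  unfold gOp
  generalize hG : (C * X * Cᵀ + R)⁻¹ = G at *
  generalize hSS : C * X * Cᵀ + R = S at *
  have hRe : R = S - C * X * Cᵀ := by rw [← hSS]; abel
  have e1 : (K - A * X * Cᵀ * G) * S = K * S - A * X * Cᵀ := by
    rw [Matrix.sub_mul, Matrix.mul_assoc _ G S, h2, Matrix.mul_one]
  have e2 : K * S * (G * (C * (X * Aᵀ))) = K * (C * (X * Aᵀ)) := by
    rw [← Matrix.mul_assoc (K * S), Matrix.mul_assoc K S G, h1, Matrix.mul_one]
  have e3 : (K - A * X * Cᵀ * G)ᵀ = Kᵀ - G * (C * (X * Aᵀ)) := by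
    simp [transpose_mul, hXt, hSt]
  rw [e1, e3, Matrix.mul_sub, Matrix.sub_mul _ _ (G * (C * (X * Aᵀ))), e2, hRe]
  simp only [transpose_sub, transpose_mul, Matrix.sub_mul, Matrix.mul_sub, Matrix.mul_assoc,
    one_smul]
  abel

lemma gOp_zero_eq {n m : ℕ} (A : Matrix (Fin n) (Fin n) ℝ) (C : Matrix (Fin m) (Fin n) ℝ)
    (Q : Matrix (Fin n) (Fin n) ℝ) (R : Matrix (Fin m) (Fin m) ℝ)
    (X : Matrix (Fin n) (Fin n) ℝ) : gOp A C Q R 0 X = A * X * Aᵀ + Q := by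
  simp [gOp]

lemma psd_conj {k l : ℕ} {X : Matrix (Fin k) (Fin k) ℝ} (hX : X.PosSemidef)
    (B : Matrix (Fin l) (Fin k) ℝ) : (B * X * Bᵀ).PosSemidef := by
  have := hX.mul_mul_conjTranspose_same B
  rwa [conjTranspose_eq_transpose_of_trivial] at this

lemma gOp_one_psd {n m : ℕ} (A : Matrix (Fin n) (Fin n) ℝ) (C : Matrix (Fin m) (Fin n) ℝ)
    (Q : Matrix (Fin n) (Fin n) ℝ) (R : Matrix (Fin m) (Fin m) ℝ) (hQ : Q.PosSemidef)
    (hR : R.PosDef) (X : Matrix (Fin n) (Fin n) ℝ) (hX : X.PosSemidef) :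
    (gOp A C Q R 1 X).PosSemidef := by
  rw [gOp_one_complete A C Q R hR X hX (A * X * Cᵀ * (C * X * Cᵀ + R)⁻¹), sub_self,
    Matrix.zero_mul, Matrix.zero_mul, sub_zero]
  exact ((psd_conj hX _).add hQ).add (psd_conj hR.posSemidef _)

lemma gOp_one_dom {n m : ℕ} (A : Matrix (Fin n) (Fin n) ℝ) (C : Matrix (Fin m) (Fin n) ℝ)
    (Q : Matrix (Fin n) (Fin n) ℝ) (R : Matrix (Fin m) (Fin m) ℝ) (hQ : Q.PosSemidef)
    (hR : R.PosDef) (β : ℝ) (hβ : 1 ≤ β) (X Y : Matrix (Fin n) (Fin n) ℝ) (hX : X.PosSemidef)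
    (hY : Y.PosSemidef) (h : (β • X - Y).PosSemidef) :
    (β • gOp A C Q R 1 X - gOp A C Q R 1 Y).PosSemidef := by
  rw [gOp_one_complete A C Q R hR X hX (A * X * Cᵀ * (C * X * Cᵀ + R)⁻¹), sub_self,
    Matrix.zero_mul, Matrix.zero_mul, sub_zero,
    gOp_one_complete A C Q R hR Y hY (A * X * Cᵀ * (C * X * Cᵀ + R)⁻¹)]
  generalize A * X * Cᵀ * (C * X * Cᵀ + R)⁻¹ = K
  have hS := psd_conj ((psd_conj hY C).add hR.posSemidef)
    (K - A * Y * Cᵀ * (C * Y * Cᵀ + R)⁻¹)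
  have hb : 0 ≤ β - 1 := by linarith
  have := ((psd_conj h (A - K * C)).add
    ((hQ.add (psd_conj hR.posSemidef K)).smul hb)).add hS
  convert this using 1
  rw [Matrix.mul_sub (A - K * C), Matrix.sub_mul _ _ (A - K * C)ᵀ, Matrix.mul_smul,
    Matrix.smul_mul]
  module

/-- Along any fixed packet-success sequence, if `P'(0) ⪯ β • P(0)` with `β ≥ 1`, then the
intermittent Kalman filter recursions preserve `P'(k) ⪯ β • P(k)` for all `k`. -/
theorem iterates_scaling_domination {n m : ℕ} (hn : 1 ≤ n)
    (A : Matrix (Fin n) (Fin n) ℝ) (C : Matrix (Fin m) (Fin n) ℝ)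
    (Q : Matrix (Fin n) (Fin n) ℝ) (R : Matrix (Fin m) (Fin m) ℝ)
    (hQ : Q.PosSemidef) (hR : R.PosDef)
    (β : ℝ) (hβ : 1 ≤ β) (γ : ℕ → Bool)
    (P P' : ℕ → Matrix (Fin n) (Fin n) ℝ)
    (hP0 : (P 0).PosSemidef) (hP'0 : (P' 0).PosSemidef)
    (hinit : (β • P 0 - P' 0).PosSemidef)
    (hPrec : ∀ k, P (k + 1) = gOp A C Q R (if γ k then (1 : ℝ) else 0) (P k))
    (hP'rec : ∀ k, P' (k + 1) = gOp A C Q R (if γ k then (1 : ℝ) else 0) (P' k)) :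
    ∀ k, (β • P k - P' k).PosSemidef := by
  have key : ∀ k, (P k).PosSemidef ∧ (P' k).PosSemidef ∧ (β • P k - P' k).PosSemidef := by
    intro k
    induction k with
    | zero => exact ⟨hP0, hP'0, hinit⟩
    | succ k ih =>
      obtain ⟨h1, h2, h3⟩ := ih
      rw [hPrec, hP'rec]
      cases γ k
      · simp only [Bool.false_eq_true, if_false, gOp_zero_eq]
        refine ⟨(psd_conj h1 A).add hQ, (psd_conj h2 A).add hQ, ?_⟩
        have hb : 0 ≤ β - 1 := by linarith
        convert (psd_conj h3 A).add (hQ.smul hb) using 1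
        rw [Matrix.mul_sub, Matrix.sub_mul, Matrix.mul_smul, Matrix.smul_mul]
        module
      · simp only [if_true]
        exact ⟨gOp_one_psd A C Q R hQ hR _ h1, gOp_one_psd A C Q R hQ hR _ h2,
          gOp_one_dom A C Q R hQ hR β hβ _ _ h1 h2 h3⟩
  exact fun k => (key k).2.2
end

section
/- Let λ ∈ [0,1], θ ∈ [0,1], Q symmetric positive semidefinite, R symmetric positive definite, and let X, Y be symmetric positive semidefinite matrices. Then θ • g_λ(X) + (1−θ) • g_λ(Y) ⪯ g_λ(θ • X + (1−θ) • Y); i.e., the modified Riccati operator g_λ is concave on the positive semidefinite cone with respect to the Loewner order. -/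
open Matrix Filter

lemma frac_sq {n m : ℕ} (B K : Matrix (Fin n) (Fin m) ℝ) (S : Matrix (Fin m) (Fin m) ℝ)
    (hS : S.PosDef) :
    (B * S⁻¹ * Bᵀ - K * Bᵀ - B * Kᵀ + K * S * Kᵀ).PosSemidef := by
  have h := hS.inv.posSemidef.mul_mul_conjTranspose_same (B - K * S)
  have hu : IsUnit S.det := (Matrix.isUnit_iff_isUnit_det S).1 hS.isUnit
  have hT : Sᵀ = S := by simpa using hS.isHermitian.eq
  have e : (B - K * S) * S⁻¹ * (B - K * S)ᴴ
      = B * S⁻¹ * Bᵀ - K * Bᵀ - B * Kᵀ + K * S * Kᵀ := by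
    rw [conjTranspose_eq_transpose_of_trivial, transpose_sub, transpose_mul, hT,
      Matrix.sub_mul B, Matrix.mul_nonsing_inv_cancel_right _ _ hu, Matrix.sub_mul,
      Matrix.mul_sub, Matrix.mul_sub, ← Matrix.mul_assoc (B * S⁻¹) S,
      Matrix.nonsing_inv_mul_cancel_right _ _ hu, ← Matrix.mul_assoc K S]
    abel
  rwa [e] at h

lemma frac_convex {n m : ℕ} (B Bp : Matrix (Fin n) (Fin m) ℝ) (S Sp : Matrix (Fin m) (Fin m) ℝ)
    (hS : S.PosDef) (hSp : Sp.PosDef) (a b : ℝ) (ha : 0 ≤ a) (hb : 0 ≤ b)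
    (hZ : (a • S + b • Sp).PosDef) :
    (a • (B * S⁻¹ * Bᵀ) + b • (Bp * Sp⁻¹ * Bpᵀ)
      - (a • B + b • Bp) * (a • S + b • Sp)⁻¹ * (a • B + b • Bp)ᵀ).PosSemidef := by
  obtain ⟨T, hT⟩ : ∃ T, T = a • S + b • Sp := ⟨_, rfl⟩
  obtain ⟨D, hD⟩ : ∃ D, D = a • B + b • Bp := ⟨_, rfl⟩
  rw [← hT] at hZ
  rw [← hT, ← hD]
  obtain ⟨K, hK⟩ : ∃ K, K = D * T⁻¹ := ⟨_, rfl⟩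
  have hu : IsUnit T.det := (Matrix.isUnit_iff_isUnit_det T).1 hZ.isUnit
  have h1 : K * T = D := by rw [hK, Matrix.nonsing_inv_mul_cancel_right _ _ hu]
  have h := ((frac_sq B K S hS).smul ha).add ((frac_sq Bp K Sp hSp).smul hb)
  convert h using 1
  have h2 : a • (K * S * Kᵀ) + b • (K * Sp * Kᵀ) = D * Kᵀ := by
    rw [← h1, hT]; simp [Matrix.mul_add, Matrix.add_mul]
  have h3 : a • (B * Kᵀ) + b • (Bp * Kᵀ) = D * Kᵀ := by
    rw [hD]; simp [Matrix.add_mul]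
  have h4 : a • (K * Bᵀ) + b • (K * Bpᵀ) = D * T⁻¹ * Dᵀ := by
    rw [← hK, hD]; simp [Matrix.mul_add]
  rw [← h4]
  have h5 := h2.trans h3.symm
  simp only [smul_add, smul_sub]
  rw [eq_comm, ← sub_eq_zero] at h5 ⊢
  rw [← neg_eq_zero, ← h5]
  abel

/-- Concavity of the modified Riccati operator on the PSD cone:
`θ • g_λ(X) + (1−θ) • g_λ(Y) ⪯ g_λ(θ • X + (1−θ) • Y)`. -/
theorem riccati_concave {n m : ℕ} (hn : 1 ≤ n)
    (A : Matrix (Fin n) (Fin n) ℝ) (C : Matrix (Fin m) (Fin n) ℝ)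
    (Q : Matrix (Fin n) (Fin n) ℝ) (R : Matrix (Fin m) (Fin m) ℝ)
    (hQ : Q.PosSemidef) (hR : R.PosDef)
    (lam : ℝ) (hlam : lam ∈ Set.Icc (0 : ℝ) 1)
    (θ : ℝ) (hθ : θ ∈ Set.Icc (0 : ℝ) 1)
    (X Y : Matrix (Fin n) (Fin n) ℝ) (hX : X.PosSemidef) (hY : Y.PosSemidef) :
    (gOp A C Q R lam (θ • X + (1 - θ) • Y) -
      (θ • gOp A C Q R lam X + (1 - θ) • gOp A C Q R lam Y)).PosSemidef := by
  obtain ⟨hl, -⟩ := hlam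
  obtain ⟨h0, h1⟩ := hθ
  have hS : ∀ P : Matrix (Fin n) (Fin n) ℝ, P.PosSemidef → (C * P * Cᵀ + R).PosDef := by
    intro P hP
    have := hP.mul_mul_conjTranspose_same C
    rw [conjTranspose_eq_transpose_of_trivial] at this
    exact Matrix.PosDef.posSemidef_add this hR
  have hb : 0 ≤ 1 - θ := by linarith
  have hE : ∀ P : Matrix (Fin n) (Fin n) ℝ, P.PosSemidef →
      gOp A C Q R lam P = A * P * Aᵀ + Q
        - lam • ((A * P * Cᵀ) * (C * P * Cᵀ + R)⁻¹ * (A * P * Cᵀ)ᵀ) := by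
    intro P hP
    have hT : Pᵀ = P := by simpa using hP.isHermitian.eq
    simp [gOp, transpose_mul, hT, Matrix.mul_assoc]
  have hZ := (hX.smul h0).add (hY.smul hb)
  have hSe : C * (θ • X + (1 - θ) • Y) * Cᵀ + R
      = θ • (C * X * Cᵀ + R) + (1 - θ) • (C * Y * Cᵀ + R) := by
    simp only [Matrix.mul_add, Matrix.add_mul, Matrix.mul_smul, Matrix.smul_mul]
    module
  have hBe : A * (θ • X + (1 - θ) • Y) * Cᵀ
      = θ • (A * X * Cᵀ) + (1 - θ) • (A * Y * Cᵀ) := by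
    simp only [Matrix.mul_add, Matrix.add_mul, Matrix.mul_smul, Matrix.smul_mul]
  have hAe : A * (θ • X + (1 - θ) • Y) * Aᵀ
      = θ • (A * X * Aᵀ) + (1 - θ) • (A * Y * Aᵀ) := by
    simp only [Matrix.mul_add, Matrix.add_mul, Matrix.mul_smul, Matrix.smul_mul]
  have hSZ := hS _ hZ
  rw [hSe] at hSZ
  have h := (frac_convex (A * X * Cᵀ) (A * Y * Cᵀ) _ _ (hS X hX) (hS Y hY) θ (1 - θ) h0 hb
    hSZ).smul hl
  rw [hE _ hZ, hE X hX, hE Y hY, hSe, hBe, hAe]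
  convert h using 1
  module
end

section
/- Let A be an n×n real matrix, Q an n×n symmetric positive semidefinite real matrix, and p₂ ∈ [0,1]. For λ ∈ [0,1] define the iterates S(λ, 0) = 0 and S(λ, k+1) = (1 − λ·p₂) • (A S(λ, k) Aᵀ) + Q. If 0 ≤ λ₂ ≤ λ₁ ≤ 1, then S(λ₁, k) ⪯ S(λ₂, k) for every k ≥ 0; in particular Tr(S(λ₁, k)) ≤ Tr(S(λ₂, k)) for all k. (Lemma 2, first part: the eavesdropper's lower-bound iterates, and hence their limit Tr S(p), are non-increasing in the transmission probability.) -/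
open Matrix Filter

/-- The eavesdropper's lower-bound Lyapunov iterates `S(λ, k)` are non-increasing in the
transmission probability λ. -/
theorem lower_bound_iterates_antitone {n : ℕ} (hn : 1 ≤ n)
    (A Q : Matrix (Fin n) (Fin n) ℝ) (hQ : Q.PosSemidef)
    (p₂ : ℝ) (hp₂ : p₂ ∈ Set.Icc (0 : ℝ) 1)
    (S : ℝ → ℕ → Matrix (Fin n) (Fin n) ℝ)
    (hS0 : ∀ lam, S lam 0 = 0)
    (hSrec : ∀ lam k, S lam (k + 1) = (1 - lam * p₂) • (A * S lam k * Aᵀ) + Q)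
    (lam₁ lam₂ : ℝ) (h0 : 0 ≤ lam₂) (h21 : lam₂ ≤ lam₁) (h1 : lam₁ ≤ 1) :
    ∀ k, (S lam₂ k - S lam₁ k).PosSemidef ∧ (S lam₁ k).trace ≤ (S lam₂ k).trace := by
  obtain ⟨hp0, hp1⟩ := hp₂
  have hc1 : 0 ≤ 1 - lam₁ * p₂ := by nlinarith
  have hc2 : 0 ≤ 1 - lam₂ * p₂ := by nlinarith
  have hd : 0 ≤ (lam₁ - lam₂) * p₂ := mul_nonneg (by linarith) hp0
  have hconj : ∀ M : Matrix (Fin n) (Fin n) ℝ, M.PosSemidef → (A * M * Aᵀ).PosSemidef := by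
    intro M hM
    have h := hM.mul_mul_conjTranspose_same A
    rwa [conjTranspose_eq_transpose_of_trivial] at h
  have hpos : ∀ k, (S lam₁ k).PosSemidef := by
    intro k
    induction k with
    | zero => rw [hS0]; exact PosSemidef.zero
    | succ k ih =>
      rw [hSrec]
      exact ((hconj _ ih).smul hc1).add hQ
  have hdiff : ∀ k, (S lam₂ k - S lam₁ k).PosSemidef := by
    intro k
    induction k with
    | zero => rw [hS0, hS0, sub_zero]; exact PosSemidef.zero
    | succ k ih =>
      have e : S lam₂ (k + 1) - S lam₁ (k + 1)
          = (1 - lam₂ * p₂) • (A * (S lam₂ k - S lam₁ k) * Aᵀ)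
            + ((lam₁ - lam₂) * p₂) • (A * S lam₁ k * Aᵀ) := by
        rw [hSrec, hSrec, Matrix.mul_sub, Matrix.sub_mul]
        module
      rw [e]
      exact ((hconj _ ih).smul hc2).add ((hconj _ (hpos k)).smul hd)
  intro k
  refine ⟨hdiff k, ?_⟩
  have h := (hdiff k).trace_nonneg
  rw [trace_sub] at h
  linarith
end

section
/- Consider a scalar system: let a, c, q, r, λ be real numbers with q > 0, r > 0, c ≠ 0, a² > 1, and 1 − 1/a² < λ ≤ 1. Then there exists a unique real number v > 0 satisfying the scalar modified algebraic Riccati equation v = a²·v + q − λ·a²·c²·v²/(c²·v + r). (This is the positive fixed point V(p) giving the user's upper bound in the scalar example of Section 5.) -/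
/-- Scalar modified algebraic Riccati equation: for an unstable scalar system with
`1 − 1/a² < λ ≤ 1`, there is a unique positive fixed point `v = a²v + q − λa²c²v²/(c²v + r)`. -/
theorem scalar_riccati_fixed_point (a c q r lam : ℝ)
    (hq : 0 < q) (hr : 0 < r) (hc : c ≠ 0) (ha : 1 < a ^ 2)
    (hlam₁ : 1 - 1 / a ^ 2 < lam) (hlam₂ : lam ≤ 1) :
    ∃! v : ℝ, 0 < v ∧
      v = a ^ 2 * v + q - lam * a ^ 2 * c ^ 2 * v ^ 2 / (c ^ 2 * v + r) := by
  have hc2 : 0 < c ^ 2 := by positivity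
  have ha0 : 0 < a ^ 2 := by linarith
  have hl : 0 < lam * a ^ 2 - a ^ 2 + 1 := by
    have h := mul_lt_mul_of_pos_right hlam₁ ha0
    rw [sub_mul, one_div, inv_mul_cancel₀ ha0.ne'] at h
    linarith
  obtain ⟨A, hA⟩ : ∃ A, A = c ^ 2 * (lam * a ^ 2 - a ^ 2 + 1) := ⟨_, rfl⟩
  obtain ⟨B, hB⟩ : ∃ B, B = (a ^ 2 - 1) * r + q * c ^ 2 := ⟨_, rfl⟩
  obtain ⟨C, hC⟩ : ∃ C, C = q * r := ⟨_, rfl⟩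
  have hA0 : 0 < A := by rw [hA]; positivity
  have hB0 : 0 < B := by
    have := mul_pos (sub_pos.2 ha) hr
    rw [hB]; positivity
  have hC0 : 0 < C := by rw [hC]; positivity
  have key : ∀ v : ℝ, 0 < v →
      (v = a ^ 2 * v + q - lam * a ^ 2 * c ^ 2 * v ^ 2 / (c ^ 2 * v + r) ↔
        A * v ^ 2 - B * v - C = 0) := by
    intro v hv
    have hd : c ^ 2 * v + r ≠ 0 := by positivity
    rw [eq_sub_iff_add_eq, ← eq_sub_iff_add_eq', div_eq_iff hd, hA, hB, hC]
    constructor <;> intro h <;> linarith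
  have hD : 0 ≤ B ^ 2 + 4 * A * C := by positivity
  have hv0 : 0 < (B + Real.sqrt (B ^ 2 + 4 * A * C)) / (2 * A) := by positivity
  have hroot : A * ((B + Real.sqrt (B ^ 2 + 4 * A * C)) / (2 * A)) ^ 2
      - B * ((B + Real.sqrt (B ^ 2 + 4 * A * C)) / (2 * A)) - C = 0 := by
    have hs := Real.sq_sqrt hD
    generalize Real.sqrt (B ^ 2 + 4 * A * C) = s at hs
    field_simp
    linarith
  generalize (B + Real.sqrt (B ^ 2 + 4 * A * C)) / (2 * A) = v at hv0 hroot
  refine ⟨v, ⟨hv0, (key v hv0).2 hroot⟩, ?_⟩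
  rintro w ⟨hw0, hw⟩
  have hw' := (key w hw0).1 hw
  have hm : (w - v) * (A * (w + v) - B) = 0 := by linarith
  rcases mul_eq_zero.1 hm with h | h
  · linarith
  · exfalso
    have h1 : 0 < A * v * w := by positivity
    have h2 : B = A * (w + v) := by linarith
    rw [h2] at hroot
    linarith
end
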